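/- Let η = diag(1,−1,−1,−1), let γ : Fin 4 → Matrix (Fin 4) (Fin 4) ℂ be a representation of the gamma matrices (γ^μ γ^ν + γ^ν γ^μ = 2 η^{μν} I), and let Λ be a real 4×4 Lorentz matrix (Λᵀ η Λ = η). Then there exists an invertible complex 4×4 matrix S(Λ) such that Σ_ν Λ^μ_ν γ^ν = S(Λ)⁻¹ γ^μ S(Λ) for all μ ∈ Fin 4. -/

import Mathlib

open Matrix

/-- The Minkowski metric matrix η = diag(1,−1,−1,−1), real version. -/
noncomputable def etaR : Matrix (Fin 4) (Fin 4) ℝ := Matrix.diagonal ![1, -1, -1, -1]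

/-- The Minkowski metric matrix η = diag(1,−1,−1,−1), complex version. -/
noncomputable def etaC : Matrix (Fin 4) (Fin 4) ℂ := Matrix.diagonal ![1, -1, -1, -1]

/-- A representation of the gamma matrices: γ^μ γ^ν + γ^ν γ^μ = 2 η^{μν} I. -/
def IsGammaRep (γ : Fin 4 → Matrix (Fin 4) (Fin 4) ℂ) : Prop :=
  ∀ μ ν : Fin 4, γ μ * γ ν + γ ν * γ μ = (2 * etaC μ ν) • (1 : Matrix (Fin 4) (Fin 4) ℂ)

/-- The canonical anticommutation relations for two modes: `a i` are the annihilation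
and `b i` the creation operators. -/
structure IsCAR {R : Type*} [Ring R] (a b : Fin 2 → R) : Prop where
  annih : ∀ i j, a i * a j + a j * a i = 0
  creat : ∀ i j, b i * b j + b j * b i = 0
  mixed : ∀ i j, a i * b j + b j * a i = if i = j then 1 else 0

/-- The annihilation operators in the Fock basis `|0⟩, b₀|0⟩, b₁|0⟩, b₀b₁|0⟩`. -/
def fockAnnih : Fin 2 → Matrix (Fin 4) (Fin 4) ℂ :=
  ![!![0, 1, 0, 0; 0, 0, 0, 0; 0, 0, 0, 1; 0, 0, 0, 0],
    !![0, 0, 1, 0; 0, 0, 0, -1; 0, 0, 0, 0; 0, 0, 0, 0]]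

/-- The creation operators in the Fock basis `|0⟩, b₀|0⟩, b₁|0⟩, b₀b₁|0⟩`. -/
def fockCreat : Fin 2 → Matrix (Fin 4) (Fin 4) ℂ :=
  ![!![0, 0, 0, 0; 1, 0, 0, 0; 0, 0, 0, 0; 0, 0, 1, 0],
    !![0, 0, 0, 0; 0, 0, 0, 0; 1, 0, 0, 0; 0, -1, 0, 0]]

namespace IsCAR

theorem annih_mul_annih_ne_zero {R : Type*} [Ring R] [Nontrivial R] {a b : Fin 2 → R}
    (h : IsCAR a b) : a 0 * a 1 ≠ 0 := by
  intro h0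
  have h00 : a 0 * b 0 + b 0 * a 0 = 1 := by simpa using h.mixed 0 0
  have h10 : a 1 * b 0 + b 0 * a 1 = 0 := by simpa using h.mixed 1 0
  have h11 : a 1 * b 1 + b 1 * a 1 = 1 := by simpa using h.mixed 1 1
  have ha1 : a 1 = 0 := by
    calc a 1 = (a 0 * b 0 + b 0 * a 0) * a 1 := by rw [h00, one_mul]
      _ = a 0 * (a 1 * b 0 + b 0 * a 1) - (a 0 * a 1) * b 0 + b 0 * (a 0 * a 1) := by
        noncomm_ring
      _ = 0 := by simp [h0, h10]
  simp [ha1] at h11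

theorem exists_vacuum {n : Type*} [Fintype n] [DecidableEq n] [Nonempty n]
    {a b : Fin 2 → Matrix n n ℂ} (h : IsCAR a b) :
    ∃ v : n → ℂ, v ≠ 0 ∧ ∀ i, a i *ᵥ v = 0 := by
  have hne := h.annih_mul_annih_ne_zero
  obtain ⟨w, hw⟩ : ∃ w, (a 0 * a 1) *ᵥ w ≠ 0 := by
    by_contra! hw
    exact hne (Matrix.ext fun i j => by simpa using congrFun (hw (Pi.single j 1)) i)
  have hsq : ∀ i, a i * a i = 0 := fun i => by
    simpa [← two_smul ℂ] using h.annih i i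
  refine ⟨_, hw, Fin.forall_fin_two.mpr ⟨?_, ?_⟩⟩
  · rw [mulVec_mulVec, ← mul_assoc, hsq, zero_mul, zero_mulVec]
  · rw [mulVec_mulVec, eq_neg_of_add_eq_zero_left (h.annih 0 1), mul_neg, ← mul_assoc, hsq,
      zero_mul, neg_zero, zero_mulVec]

/-- Every representation of the two-mode CAR on `ℂ⁴` is equivalent to the Fock representation. -/
theorem exists_fock_intertwiner {a b : Fin 2 → Matrix (Fin 4) (Fin 4) ℂ} (h : IsCAR a b) :
    ∃ P : Matrix (Fin 4) (Fin 4) ℂ, IsUnit P.det ∧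
      ∀ i, a i * P = P * fockAnnih i ∧ b i * P = P * fockCreat i := by
  obtain ⟨v, hv, hav⟩ := h.exists_vacuum
  have hbb : ∀ i (w : Fin 4 → ℂ), b i *ᵥ b i *ᵥ w = 0 := fun i w => by
    have hsq : b i * b i = 0 := by simpa [← two_smul ℂ] using h.creat i i
    rw [mulVec_mulVec, hsq, zero_mulVec]
  have hba : ∀ w, b 1 *ᵥ b 0 *ᵥ w = -(b 0 *ᵥ b 1 *ᵥ w) := fun w => by
    rw [mulVec_mulVec, mulVec_mulVec, eq_neg_of_add_eq_zero_left (h.creat 1 0), neg_mulVec]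
  have hab : ∀ i j (w : Fin 4 → ℂ),
      a i *ᵥ b j *ᵥ w = (if i = j then w else 0) - b j *ᵥ a i *ᵥ w := fun i j w => by
    rw [mulVec_mulVec, eq_sub_of_add_eq (h.mixed i j), sub_mulVec, mulVec_mulVec]
    split_ifs <;> simp
  set P : Matrix (Fin 4) (Fin 4) ℂ :=
    (Matrix.of ![v, b 0 *ᵥ v, b 1 *ᵥ v, b 0 *ᵥ b 1 *ᵥ v])ᵀ with hP
  have hcol : ∀ M N : Matrix (Fin 4) (Fin 4) ℂ,
      (∀ j, M *ᵥ P.col j = P *ᵥ N.col j) → M * P = P * N := fun M N hMN =>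
    Matrix.ext fun i j => congrFun (hMN j) i
  have hPv : ∀ x, P *ᵥ x =
      x 0 • v + x 1 • b 0 *ᵥ v + x 2 • b 1 *ᵥ v + x 3 • b 0 *ᵥ b 1 *ᵥ v := fun x => by
    ext i
    simp [hP, mulVec, dotProduct, Fin.sum_univ_four, mul_comm]
  obtain ⟨hc0, hc1, hc2, hc3⟩ : P.col 0 = v ∧ P.col 1 = b 0 *ᵥ v ∧ P.col 2 = b 1 *ᵥ v ∧
      P.col 3 = b 0 *ᵥ b 1 *ᵥ v := ⟨rfl, rfl, rfl, rfl⟩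
  have hA : ∀ i, a i * P = P * fockAnnih i := Fin.forall_fin_two.mpr (by
    constructor <;> refine hcol _ _ fun j => ?_ <;> rw [hPv] <;> fin_cases j <;>
      simp [-mulVec_mulVec, fockAnnih, hc0, hc1, hc2, hc3, hab, hav])
  have hB : ∀ i, b i * P = P * fockCreat i := Fin.forall_fin_two.mpr (by
    constructor <;> refine hcol _ _ fun j => ?_ <;> rw [hPv] <;> fin_cases j <;>
      simp [-mulVec_mulVec, fockCreat, hc0, hc1, hc2, hc3, hbb, hba])
  refine ⟨P, ?_, fun i => ⟨hA i, hB i⟩⟩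
  rw [isUnit_iff_ne_zero]
  intro hdet
  obtain ⟨x, hx, hPx⟩ := Matrix.exists_mulVec_eq_zero_iff.mpr hdet
  have key : ∀ M N : Matrix (Fin 4) (Fin 4) ℂ, ∀ y, M * P = P * N → P *ᵥ y = 0 →
      P *ᵥ N *ᵥ y = 0 := fun M N y hMN hy => by
    rw [mulVec_mulVec, ← hMN, ← mulVec_mulVec, hy, mulVec_zero]
  have h0 := key _ _ _ (hA 0) hPx
  have h1 := key _ _ _ (hA 1) hPx
  have h01 := key _ _ _ (hA 1) h0
  simp [hPv, fockAnnih, dotProduct, Fin.sum_univ_four, hv] at h01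
  simp [hPv, fockAnnih, dotProduct, Fin.sum_univ_four, hv, h01] at h0 h1
  simp [hPv, h0, h1, h01, hv] at hPx
  exact hx (funext fun i => by fin_cases i <;> assumption)

end IsCAR

theorem IsGammaRep.isCAR {γ : Fin 4 → Matrix (Fin 4) (Fin 4) ℂ} (hγ : IsGammaRep γ) :
    IsCAR ![(1 / 2 : ℂ) • (γ 0 + γ 1), (1 / 2 : ℂ) • (Complex.I • γ 2 + γ 3)]
      ![(1 / 2 : ℂ) • (γ 0 - γ 1), (1 / 2 : ℂ) • (Complex.I • γ 2 - γ 3)] := by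
  have hsq : ∀ μ, γ μ * γ μ = etaC μ μ • 1 := fun μ => by
    have := hγ μ μ
    rw [← two_smul ℂ, mul_smul] at this
    exact smul_right_injective _ two_ne_zero this
  have h0 : γ 0 * γ 0 = 1 := by simp [hsq, etaC]
  have h1 : γ 1 * γ 1 = -1 := by simp [hsq, etaC]
  have h2 : γ 2 * γ 2 = -1 := by simp [hsq, etaC]
  have h3 : γ 3 * γ 3 = -1 := by simp [hsq, etaC]
  have hne : ∀ μ ν, ν ≠ μ → γ μ * γ ν = -(γ ν * γ μ) := fun μ ν hμν =>
    eq_neg_of_add_eq_zero_left (by simp [hγ μ ν, etaC, hμν.symm])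
  have h10 := hne 1 0 (by decide)
  have h20 := hne 2 0 (by decide)
  have h30 := hne 3 0 (by decide)
  have h21 := hne 2 1 (by decide)
  have h31 := hne 3 1 (by decide)
  have h32 := hne 3 2 (by decide)
  constructor <;> intro i j <;> fin_cases i <;> fin_cases j <;>
    simp [mul_add, add_mul, mul_sub, sub_mul, smul_smul, h0, h1, h2, h3, h10, h20, h30, h21, h31,
      h32] <;>
        match_scalars <;> ring_nf <;> norm_num [Complex.I_sq]

/-- **Pauli's fundamental theorem**: any two gamma representations are equivalent. -/
theorem IsGammaRep.exists_intertwiner {γ γ' : Fin 4 → Matrix (Fin 4) (Fin 4) ℂ}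
    (hγ : IsGammaRep γ) (hγ' : IsGammaRep γ') :
    ∃ S : Matrix (Fin 4) (Fin 4) ℂ, IsUnit S.det ∧ ∀ μ, γ' μ = S⁻¹ * γ μ * S := by
  have fock : ∀ {δ : Fin 4 → Matrix (Fin 4) (Fin 4) ℂ}, IsGammaRep δ →
      ∃ P : Matrix (Fin 4) (Fin 4) ℂ, IsUnit P.det ∧ ∀ μ, δ μ * P = P *
        ![fockAnnih 0 + fockCreat 0, fockAnnih 0 - fockCreat 0,
          -Complex.I • (fockAnnih 1 + fockCreat 1), fockAnnih 1 - fockCreat 1] μ := by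
    intro δ hδ
    obtain ⟨P, hP, h⟩ := hδ.isCAR.exists_fock_intertwiner
    obtain ⟨ha0, hb0⟩ := h 0
    obtain ⟨ha1, hb1⟩ := h 1
    refine ⟨P, hP, fun μ => ?_⟩
    fin_cases μ <;>
      simp [mul_add, mul_sub, ← ha0, ← hb0, ← ha1, ← hb1, add_mul, sub_mul, smul_smul] <;>
        match_scalars <;> ring_nf <;> norm_num [Complex.I_sq]
  obtain ⟨P, hP, h⟩ := fock hγ
  obtain ⟨P', hP', h'⟩ := fock hγ'
  refine ⟨P * P'⁻¹, ?_, fun μ => ?_⟩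
  · rw [det_mul]
    exact hP.mul (isUnit_nonsing_inv_det _ hP')
  · rw [Matrix.mul_inv_rev, nonsing_inv_nonsing_inv _ hP', mul_assoc, ← mul_assoc (γ μ), h, mul_assoc,
      mul_assoc, nonsing_inv_mul_cancel_left _ _ hP, ← mul_assoc, ← h',
      mul_nonsing_inv_cancel_right _ _ hP']

theorem lorentz_mul_eta_mul_transpose {L : Matrix (Fin 4) (Fin 4) ℝ}
    (hL : Lᵀ * etaR * L = etaR) : L * etaR * Lᵀ = etaR := by
  have hη : etaR * etaR = 1 := by
    rw [etaR, diagonal_mul_diagonal, ← diagonal_one]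
    congr 1
    ext i
    fin_cases i <;> simp
  have h : L * (etaR * Lᵀ * etaR) = 1 := mul_eq_one_comm.mp (by
    rw [mul_assoc, mul_assoc, ← mul_assoc Lᵀ, hL, hη])
  calc L * etaR * Lᵀ = L * (etaR * Lᵀ * etaR) * etaR := by simp only [mul_assoc, hη, mul_one]
    _ = etaR := by rw [h, one_mul]

theorem IsGammaRep.lorentz {γ : Fin 4 → Matrix (Fin 4) (Fin 4) ℂ} (hγ : IsGammaRep γ)
    {L : Matrix (Fin 4) (Fin 4) ℝ} (hL : Lᵀ * etaR * L = etaR) :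
    IsGammaRep fun μ => ∑ ν, (L μ ν : ℂ) • γ ν := by
  intro μ ν
  have hC : etaC μ ν = ((etaR μ ν : ℝ) : ℂ) := by
    fin_cases μ <;> fin_cases ν <;> simp [etaC, etaR]
  have hη : ∑ α, ∑ β, (L μ α * L ν β : ℂ) * etaC α β = etaC μ ν := by
    rw [hC, ← lorentz_mul_eta_mul_transpose hL]
    simp [etaR, etaC, mul_apply, Fin.sum_univ_four]
  calc _ = ∑ α, ∑ β, (L μ α * L ν β : ℂ) • (γ α * γ β + γ β * γ α) := by
        simp only [Finset.sum_mul_sum, smul_mul_smul_comm, smul_add, Finset.sum_add_distrib]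
        congr 1
        rw [Finset.sum_comm]
        simp only [mul_comm]
    _ = _ := by
        simp only [hγ _ _, smul_smul, ← Finset.sum_smul, ← hη, Finset.mul_sum]
        congr 1
        exact Finset.sum_congr rfl fun α _ => Finset.sum_congr rfl fun β _ => by ring

/-- For a gamma representation γ and a Lorentz matrix Λ there exists an invertible
matrix S(Λ) with Σ_ν Λ^μ_ν γ^ν = S(Λ)⁻¹ γ^μ S(Λ) for all μ. -/
theorem exists_spin_intertwiner
    (γ : Fin 4 → Matrix (Fin 4) (Fin 4) ℂ) (hγ : IsGammaRep γ)
    (Lam : Matrix (Fin 4) (Fin 4) ℝ) (hLam : Lamᵀ * etaR * Lam = etaR) :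
    ∃ S : Matrix (Fin 4) (Fin 4) ℂ, IsUnit S.det ∧
      ∀ μ : Fin 4, ∑ ν : Fin 4, ((Lam μ ν : ℝ) : ℂ) • γ ν = S⁻¹ * γ μ * S := by
  exact hγ.exists_intertwiner (hγ.lorentz hLam)
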